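/- Let (A,Δ) be an algebraic quantum group with antipode S and dual antipode Ŝ. Then for every ω ∈ M(Â): Ŝ(ω) = ω∘S and Ŝ⁻¹(ω) = ω∘S⁻¹. -/

import Mathlib

open TensorProduct LinearMap

noncomputable section

/-- Slice on the left leg: `sliceL θ (x ⊗ y) = θ x • y`, i.e. `(θ ⊙ ι)`. -/
def sliceL {M N : Type*} [AddCommGroup M] [Module ℂ M] [AddCommGroup N] [Module ℂ N]
    (θ : M →ₗ[ℂ] ℂ) : M ⊗[ℂ] N →ₗ[ℂ] N :=
  TensorProduct.lift (LinearMap.lsmul ℂ N ∘ₗ θ)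

/-- Slice on the right leg: `sliceR θ (x ⊗ y) = θ y • x`, i.e. `(ι ⊙ θ)`. -/
def sliceR {M N : Type*} [AddCommGroup M] [Module ℂ M] [AddCommGroup N] [Module ℂ N]
    (θ : N →ₗ[ℂ] ℂ) : M ⊗[ℂ] N →ₗ[ℂ] M :=
  TensorProduct.lift ((LinearMap.lsmul ℂ M ∘ₗ θ).flip)

/-- An algebraic quantum group: a regular multiplier Hopf algebra `(A, Δ)` with a
(faithful) left invariant functional `φ`.  The comultiplication is encoded through the
canonical bijections `T1 a ⊗ b = Δ(a)(b ⊗ 1)`, `T2 (a ⊗ b) = Δ(a)(1 ⊗ b)`,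
`T3 (a ⊗ b) = (b ⊗ 1)Δ(a)`, `T4 (a ⊗ b) = (1 ⊗ b)Δ(a)` together with the left and right
multiplication operators `ΔL a`/`ΔR a` by `Δ(a)` on `A ⊗ A`. -/
structure AQG (A : Type*) [NonUnitalRing A] [Module ℂ A]
    [SMulCommClass ℂ A A] [IsScalarTower ℂ A A] where
  T1 : A ⊗[ℂ] A ≃ₗ[ℂ] A ⊗[ℂ] A
  T2 : A ⊗[ℂ] A ≃ₗ[ℂ] A ⊗[ℂ] A
  T3 : A ⊗[ℂ] A ≃ₗ[ℂ] A ⊗[ℂ] A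
  T4 : A ⊗[ℂ] A ≃ₗ[ℂ] A ⊗[ℂ] A
  counit : A →ₗ[ℂ] ℂ
  S : A ≃ₗ[ℂ] A
  phi : A →ₗ[ℂ] ℂ
  rho : A ≃ₗ[ℂ] A
  ΔL : A →ₗ[ℂ] (A ⊗[ℂ] A →ₗ[ℂ] A ⊗[ℂ] A)
  ΔR : A →ₗ[ℂ] (A ⊗[ℂ] A →ₗ[ℂ] A ⊗[ℂ] A)
  /- non-degeneracy of the algebra `A` -/
  nondeg_l : ∀ a : A, (∀ b : A, a * b = 0) → a = 0
  nondeg_r : ∀ a : A, (∀ b : A, b * a = 0) → a = 0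
  /- the counit is a non-zero homomorphism with `(ε ⊙ ι)Δ = (ι ⊙ ε)Δ = ι` -/
  counit_mul : ∀ a b : A, counit (a * b) = counit a * counit b
  counit_ne : counit ≠ 0
  counit_T1 : ∀ a b : A, sliceR counit (T1 (a ⊗ₜ b)) = a * b
  counit_T2 : ∀ a b : A, sliceL counit (T2 (a ⊗ₜ b)) = a * b
  counit_T3 : ∀ a b : A, sliceR counit (T3 (a ⊗ₜ b)) = b * a
  counit_T4 : ∀ a b : A, sliceL counit (T4 (a ⊗ₜ b)) = b * a
  /- the antipode -/
  S_mul : ∀ a b : A, S (a * b) = S b * S a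
  antipode_l : ∀ a b : A,
    LinearMap.mul' ℂ A (LinearMap.rTensor A S.toLinearMap (T2 (a ⊗ₜ b))) = counit a • b
  antipode_r : ∀ a b : A,
    LinearMap.mul' ℂ A (LinearMap.lTensor A S.toLinearMap (T3 (a ⊗ₜ b))) = counit a • b
  /- `φ` is a faithful left invariant functional -/
  phi_ne : phi ≠ 0
  phi_faithful_l : ∀ a : A, (∀ b : A, phi (a * b) = 0) → a = 0
  phi_faithful_r : ∀ a : A, (∀ b : A, phi (b * a) = 0) → a = 0
  left_inv_T1 : ∀ a b : A, sliceR phi (T1 (a ⊗ₜ b)) = phi a • b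
  left_inv_T3 : ∀ a b : A, sliceR phi (T3 (a ⊗ₜ b)) = phi a • b
  /- the weak KMS automorphism `ρ`: `φ(ab) = φ(b ρ(a))` -/
  rho_mul : ∀ a b : A, rho (a * b) = rho a * rho b
  phi_kms : ∀ a b : A, phi (a * b) = phi (b * rho a)
  /- `Δ` is a (non-degenerate) homomorphism into `M(A ⊗ A)` -/
  ΔL_mul : ∀ (a b : A) (z : A ⊗[ℂ] A), ΔL (a * b) z = ΔL a (ΔL b z)
  ΔR_mul : ∀ (a b : A) (z : A ⊗[ℂ] A), ΔR (a * b) z = ΔR b (ΔR a z)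
  ΔL_assoc : ∀ (a : A) (z w : A ⊗[ℂ] A), ΔL a (z * w) = ΔL a z * w
  ΔR_assoc : ∀ (a : A) (z w : A ⊗[ℂ] A), ΔR a (z * w) = z * ΔR a w
  ΔLR : ∀ (a : A) (z w : A ⊗[ℂ] A), ΔR a z * w = z * ΔL a w
  ΔL_T1 : ∀ (a b : A) (z : A ⊗[ℂ] A),
    T1 (a ⊗ₜ b) * z = ΔL a (TensorProduct.map (LinearMap.mulLeft ℂ b) LinearMap.id z)
  ΔL_T2 : ∀ (a b : A) (z : A ⊗[ℂ] A),
    T2 (a ⊗ₜ b) * z = ΔL a (TensorProduct.map LinearMap.id (LinearMap.mulLeft ℂ b) z)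
  ΔR_T3 : ∀ (a b : A) (z : A ⊗[ℂ] A),
    z * T3 (a ⊗ₜ b) = ΔR a (TensorProduct.map (LinearMap.mulRight ℂ b) LinearMap.id z)
  ΔR_T4 : ∀ (a b : A) (z : A ⊗[ℂ] A),
    z * T4 (a ⊗ₜ b) = ΔR a (TensorProduct.map LinearMap.id (LinearMap.mulRight ℂ b) z)
  /- coassociativity of `Δ` -/
  coassoc : ∀ a b c : A,
    (TensorProduct.assoc ℂ A A A)
        (LinearMap.rTensor A (T3.toLinearMap ∘ₗ (TensorProduct.mk ℂ A A).flip a)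
          (T2 (c ⊗ₜ b)))
      = LinearMap.lTensor A (T2.toLinearMap ∘ₗ (TensorProduct.mk ℂ A A).flip b)
          (T3 (c ⊗ₜ a))

namespace AQG

variable {A : Type*} [NonUnitalRing A] [Module ℂ A]
  [SMulCommClass ℂ A A] [IsScalarTower ℂ A A] (H : AQG A)

/-- The functional `φa : x ↦ φ(x a)`; the dual algebra is `Â = {φa : a ∈ A}`. -/
def lFun (a : A) : A →ₗ[ℂ] ℂ := H.phi ∘ₗ LinearMap.mulRight ℂ a

/-- The functional `aφ : x ↦ φ(a x)`; also `Â = {aφ : a ∈ A}`. -/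
def rFun (a : A) : A →ₗ[ℂ] ℂ := H.phi ∘ₗ LinearMap.mulLeft ℂ a

/-- The right invariant functional `ψ = φ ∘ S`. -/
def psi : A →ₗ[ℂ] ℂ := H.phi ∘ₗ H.S.toLinearMap

/-- The functional `ψa : x ↦ ψ(x a)`. -/
def lFunPsi (a : A) : A →ₗ[ℂ] ℂ := H.psi ∘ₗ LinearMap.mulRight ℂ a

/-- The right action of `Â` on `A'`: `Ract θ a = θ · (φa)`,
`(θ (φa))(x) = θ((ι ⊙ φa)Δ(x)) = θ((ι ⊙ φ)(Δ(x)(1 ⊗ a)))`. -/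
def Ract (θ : A →ₗ[ℂ] ℂ) (a : A) : A →ₗ[ℂ] ℂ :=
  θ ∘ₗ sliceR H.phi ∘ₗ H.T2.toLinearMap ∘ₗ (TensorProduct.mk ℂ A A).flip a

/-- The left action of `Â` on `A'`: `Lact θ a = (φa) · θ`,
`((φa) θ)(x) = θ((φa ⊙ ι)Δ(x)) = θ((φ ⊙ ι)(Δ(x)(a ⊗ 1)))`. -/
def Lact (θ : A →ₗ[ℂ] ℂ) (a : A) : A →ₗ[ℂ] ℂ :=
  θ ∘ₗ sliceL H.phi ∘ₗ H.T1.toLinearMap ∘ₗ (TensorProduct.mk ℂ A A).flip a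

/-- `c = (ι ⊙ θ)Δ(x)` as an element of `A` (a priori it is only a multiplier). -/
def IsRSlice (θ : A →ₗ[ℂ] ℂ) (x c : A) : Prop :=
  (∀ b : A, c * b = sliceR θ (H.T1 (x ⊗ₜ b))) ∧
  (∀ b : A, b * c = sliceR θ (H.T3 (x ⊗ₜ b)))

/-- `c = (θ ⊙ ι)Δ(x)` as an element of `A`. -/
def IsLSlice (θ : A →ₗ[ℂ] ℂ) (x c : A) : Prop :=
  (∀ b : A, c * b = sliceL θ (H.T2 (x ⊗ₜ b))) ∧
  (∀ b : A, b * c = sliceL θ (H.T4 (x ⊗ₜ b)))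

/-- `θ ∈ M(Â)`: all slices `(θ ⊙ ι)Δ(x)` and `(ι ⊙ θ)Δ(x)` belong to `A`. -/
def HasSlices (θ : A →ₗ[ℂ] ℂ) : Prop :=
  ∀ x : A, (∃ c, H.IsRSlice θ x c) ∧ (∃ c, H.IsLSlice θ x c)

end AQG

end

namespace AQG
section Aux
set_option linter.unusedSectionVars false
variable {A : Type*} [NonUnitalRing A] [Module ℂ A]
  [SMulCommClass ℂ A A] [IsScalarTower ℂ A A]

theorem sliceL_tmul {M N : Type*} [AddCommGroup M] [Module ℂ M] [AddCommGroup N] [Module ℂ N]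
    (θ : M →ₗ[ℂ] ℂ) (x : M) (y : N) : sliceL θ (x ⊗ₜ[ℂ] y) = θ x • y := by
  simp [sliceL]

theorem sliceR_tmul {M N : Type*} [AddCommGroup M] [Module ℂ M] [AddCommGroup N] [Module ℂ N]
    (θ : N →ₗ[ℂ] ℂ) (x : M) (y : N) : sliceR θ (x ⊗ₜ[ℂ] y) = θ y • x := by
  simp [sliceR]

theorem sliceR_sep {M N : Type*} [AddCommGroup M] [Module ℂ M] [AddCommGroup N] [Module ℂ N]
    (w : M ⊗[ℂ] N) (h : ∀ θ : N →ₗ[ℂ] ℂ, sliceR θ w = 0) : w = 0 := by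
  classical
  let B := Module.Basis.ofVectorSpace ℂ N
  apply (TensorProduct.equivFinsuppOfBasisRight (M := M) B).injective
  rw [map_zero]
  ext i
  have h2 := h (B.coord i)
  refine Eq.trans ?_ h2
  generalize w = z
  induction z with
  | zero => simp
  | tmul a b => simp [sliceR_tmul]
  | add x y hx hy => simp [map_add, hx, hy]

/-- right multiplication on leg 1 -/
def rm1 (c : A) : A ⊗[ℂ] A →ₗ[ℂ] A ⊗[ℂ] A := TensorProduct.map (LinearMap.mulRight ℂ c) LinearMap.id
def rm2 (c : A) : A ⊗[ℂ] A →ₗ[ℂ] A ⊗[ℂ] A := TensorProduct.map LinearMap.id (LinearMap.mulRight ℂ c)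
def lm1 (c : A) : A ⊗[ℂ] A →ₗ[ℂ] A ⊗[ℂ] A := TensorProduct.map (LinearMap.mulLeft ℂ c) LinearMap.id
def lm2 (c : A) : A ⊗[ℂ] A →ₗ[ℂ] A ⊗[ℂ] A := TensorProduct.map LinearMap.id (LinearMap.mulLeft ℂ c)
/-- flip composed with `S ⊗ S` -/
def sw (H : AQG A) : A ⊗[ℂ] A →ₗ[ℂ] A ⊗[ℂ] A :=
  (TensorProduct.comm ℂ A A).toLinearMap ∘ₗ TensorProduct.map H.S.toLinearMap H.S.toLinearMap

theorem rm1_t (c x y : A) : rm1 c (x ⊗ₜ[ℂ] y) = (x * c) ⊗ₜ y := by simp [rm1]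
theorem rm2_t (c x y : A) : rm2 c (x ⊗ₜ[ℂ] y) = x ⊗ₜ (y * c) := by simp [rm2]
theorem lm1_t (c x y : A) : lm1 c (x ⊗ₜ[ℂ] y) = (c * x) ⊗ₜ y := by simp [lm1]
theorem lm2_t (c x y : A) : lm2 c (x ⊗ₜ[ℂ] y) = x ⊗ₜ (c * y) := by simp [lm2]
theorem sw_t (H : AQG A) (x y : A) : H.sw (x ⊗ₜ[ℂ] y) = H.S y ⊗ₜ H.S x := by simp [sw]

theorem sR_rm1 (θ : A →ₗ[ℂ] ℂ) (c : A) (z : A ⊗[ℂ] A) : sliceR θ (rm1 c z) = sliceR θ z * c := by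
  induction z with
  | zero => simp
  | tmul a b => simp [sliceR_tmul, rm1_t, smul_mul_assoc]
  | add x y hx hy => simp [map_add, hx, hy, add_mul]
theorem sR_lm1 (θ : A →ₗ[ℂ] ℂ) (c : A) (z : A ⊗[ℂ] A) : sliceR θ (lm1 c z) = c * sliceR θ z := by
  induction z with
  | zero => simp
  | tmul a b => simp [sliceR_tmul, lm1_t, mul_smul_comm]
  | add x y hx hy => simp [map_add, hx, hy, mul_add]
theorem sL_rm2 (θ : A →ₗ[ℂ] ℂ) (c : A) (z : A ⊗[ℂ] A) : sliceL θ (rm2 c z) = sliceL θ z * c := by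
  induction z with
  | zero => simp
  | tmul a b => simp [sliceL_tmul, rm2_t, smul_mul_assoc]
  | add x y hx hy => simp [map_add, hx, hy, add_mul]
theorem sL_lm2 (θ : A →ₗ[ℂ] ℂ) (c : A) (z : A ⊗[ℂ] A) : sliceL θ (lm2 c z) = c * sliceL θ z := by
  induction z with
  | zero => simp
  | tmul a b => simp [sliceL_tmul, lm2_t, mul_smul_comm]
  | add x y hx hy => simp [map_add, hx, hy, mul_add]

theorem sw_rm1 (H : AQG A) (c : A) (z : A ⊗[ℂ] A) : H.sw (rm1 c z) = lm2 (H.S c) (H.sw z) := by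
  induction z with
  | zero => simp
  | tmul a b => simp [sw_t, rm1_t, lm2_t, H.S_mul]
  | add x y hx hy => simp [map_add, hx, hy]
theorem sw_rm2 (H : AQG A) (c : A) (z : A ⊗[ℂ] A) : H.sw (rm2 c z) = lm1 (H.S c) (H.sw z) := by
  induction z with
  | zero => simp
  | tmul a b => simp [sw_t, rm2_t, lm1_t, H.S_mul]
  | add x y hx hy => simp [map_add, hx, hy]
theorem sw_lm1 (H : AQG A) (c : A) (z : A ⊗[ℂ] A) : H.sw (lm1 c z) = rm2 (H.S c) (H.sw z) := by
  induction z with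
  | zero => simp
  | tmul a b => simp [sw_t, lm1_t, rm2_t, H.S_mul]
  | add x y hx hy => simp [map_add, hx, hy]
theorem sw_lm2 (H : AQG A) (c : A) (z : A ⊗[ℂ] A) : H.sw (lm2 c z) = rm1 (H.S c) (H.sw z) := by
  induction z with
  | zero => simp
  | tmul a b => simp [sw_t, lm2_t, rm1_t, H.S_mul]
  | add x y hx hy => simp [map_add, hx, hy]

theorem sR_sw (H : AQG A) (θ : A →ₗ[ℂ] ℂ) (z : A ⊗[ℂ] A) :
    sliceR θ (H.sw z) = H.S (sliceL (θ ∘ₗ H.S.toLinearMap) z) := by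
  induction z with
  | zero => simp
  | tmul a b => simp [sw_t, sliceR_tmul, sliceL_tmul]
  | add x y hx hy => simp [map_add, hx, hy]
theorem sL_sw (H : AQG A) (θ : A →ₗ[ℂ] ℂ) (z : A ⊗[ℂ] A) :
    sliceL θ (H.sw z) = H.S (sliceR (θ ∘ₗ H.S.toLinearMap) z) := by
  induction z with
  | zero => simp
  | tmul a b => simp [sw_t, sliceR_tmul, sliceL_tmul]
  | add x y hx hy => simp [map_add, hx, hy]

theorem sliceRL (θ η : A →ₗ[ℂ] ℂ) (z : A ⊗[ℂ] A) : θ (sliceR η z) = η (sliceL θ z) := by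
  induction z with
  | zero => simp
  | tmul a b => simp [sliceR_tmul, sliceL_tmul, mul_comm]
  | add x y hx hy => simp [map_add, hx, hy]

theorem sliceL_comm (θ : A →ₗ[ℂ] ℂ) (z : A ⊗[ℂ] A) :
    sliceR θ (TensorProduct.comm ℂ A A z) = sliceL θ z := by
  induction z with
  | zero => simp
  | tmul a b => simp [sliceR_tmul, sliceL_tmul]
  | add x y hx hy => simp [map_add, hx, hy]

theorem sliceL_sep (w : A ⊗[ℂ] A) (h : ∀ θ : A →ₗ[ℂ] ℂ, sliceL θ w = 0) : w = 0 := by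
  apply (TensorProduct.comm ℂ A A).injective
  rw [map_zero]
  exact sliceR_sep _ fun θ => by rw [sliceL_comm, h]

theorem nd_rm1 (H : AQG A) {w z : A ⊗[ℂ] A} (h : ∀ c, rm1 c w = rm1 c z) : w = z := by
  rw [← sub_eq_zero]
  refine sliceR_sep _ fun θ => H.nondeg_l _ fun b => ?_
  rw [← sR_rm1, map_sub, h, sub_self, map_zero]
theorem nd_lm1 (H : AQG A) {w z : A ⊗[ℂ] A} (h : ∀ c, lm1 c w = lm1 c z) : w = z := by
  rw [← sub_eq_zero]
  refine sliceR_sep _ fun θ => H.nondeg_r _ fun b => ?_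
  rw [← sR_lm1, map_sub, h, sub_self, map_zero]
theorem nd_rm2 (H : AQG A) {w z : A ⊗[ℂ] A} (h : ∀ c, rm2 c w = rm2 c z) : w = z := by
  rw [← sub_eq_zero]
  refine sliceL_sep _ fun θ => H.nondeg_l _ fun b => ?_
  rw [← sL_rm2, map_sub, h, sub_self, map_zero]
theorem nd_lm2 (H : AQG A) {w z : A ⊗[ℂ] A} (h : ∀ c, lm2 c w = lm2 c z) : w = z := by
  rw [← sub_eq_zero]
  refine sliceL_sep _ fun θ => H.nondeg_r _ fun b => ?_
  rw [← sL_lm2, map_sub, h, sub_self, map_zero]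

theorem mul_t (w : A ⊗[ℂ] A) (a b : A) : w * (a ⊗ₜ b) = rm1 a (rm2 b w) := by
  induction w with
  | zero => simp
  | tmul x y => simp [rm1_t, rm2_t]
  | add x y hx hy => simp [map_add, hx, hy, add_mul]
theorem t_mul (w : A ⊗[ℂ] A) (a b : A) : (a ⊗ₜ b) * w = lm1 a (lm2 b w) := by
  induction w with
  | zero => simp
  | tmul x y => simp [lm1_t, lm2_t]
  | add x y hx hy => simp [map_add, hx, hy, mul_add]

theorem nd_r (H : AQG A) {w z : A ⊗[ℂ] A} (h : ∀ y, w * y = z * y) : w = z :=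
  H.nd_rm2 fun b => H.nd_rm1 fun a => by rw [← mul_t, ← mul_t, h]
theorem nd_l (H : AQG A) {w z : A ⊗[ℂ] A} (h : ∀ y, y * w = y * z) : w = z :=
  H.nd_lm2 fun b => H.nd_lm1 fun a => by rw [← t_mul, ← t_mul, h]

theorem rm1_mul (c : A) (z y : A ⊗[ℂ] A) : rm1 c z * y = z * lm1 c y := by
  induction z with
  | zero => simp
  | add x y hx hy => simp [map_add, hx, hy, add_mul]
  | tmul p q =>
    induction y with
    | zero => simp
    | tmul a b => simp [rm1_t, lm1_t, mul_assoc]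
    | add x y hx hy => simp [map_add, hx, hy, mul_add]
theorem rm2_mul (c : A) (z y : A ⊗[ℂ] A) : rm2 c z * y = z * lm2 c y := by
  induction z with
  | zero => simp
  | add x y hx hy => simp [map_add, hx, hy, add_mul]
  | tmul p q =>
    induction y with
    | zero => simp
    | tmul a b => simp [rm2_t, lm2_t, mul_assoc]
    | add x y hx hy => simp [map_add, hx, hy, mul_add]

theorem T2L (H : AQG A) (v t s : A) : rm1 s (H.T2 (v ⊗ₜ t)) = H.ΔL v (s ⊗ₜ t) := by
  refine H.nd_r fun y => ?_
  rw [rm1_mul, H.ΔL_T2, ← H.ΔL_assoc, t_mul]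
  congr 1
  change lm2 t (lm1 s y) = _
  induction y with
  | zero => simp
  | tmul a b => simp [lm1_t, lm2_t]
  | add x y hx hy => simp only [map_add, hx, hy]
theorem T1L (H : AQG A) (v t s : A) : rm2 t (H.T1 (v ⊗ₜ s)) = H.ΔL v (s ⊗ₜ t) := by
  refine H.nd_r fun y => ?_
  rw [rm2_mul, H.ΔL_T1, ← H.ΔL_assoc, t_mul]
  rfl
theorem T3R (H : AQG A) (v t s : A) : lm2 t (H.T3 (v ⊗ₜ s)) = H.ΔR v (s ⊗ₜ t) := by
  refine H.nd_l fun y => ?_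
  rw [← rm2_mul, H.ΔR_T3, ← H.ΔR_assoc, mul_t]
  rfl
theorem T4R (H : AQG A) (v t s : A) : lm1 s (H.T4 (v ⊗ₜ t)) = H.ΔR v (s ⊗ₜ t) := by
  refine H.nd_l fun y => ?_
  rw [← rm1_mul, H.ΔR_T4, ← H.ΔR_assoc, mul_t]
  congr 1
  change rm2 t (rm1 s y) = _
  induction y with
  | zero => simp
  | tmul a b => simp [rm1_t, rm2_t]
  | add x y hx hy => simp only [map_add, hx, hy]

theorem C12 (H : AQG A) (v t s : A) : rm1 s (H.T2 (v ⊗ₜ t)) = rm2 t (H.T1 (v ⊗ₜ s)) := by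
  rw [T2L, T1L]
theorem C34 (H : AQG A) (v t s : A) : lm1 s (H.T4 (v ⊗ₜ t)) = lm2 t (H.T3 (v ⊗ₜ s)) := by
  rw [T3R, T4R]
theorem C23 (H : AQG A) (a b p : A) : lm1 p (H.T2 (a ⊗ₜ b)) = rm2 b (H.T3 (a ⊗ₜ p)) := by
  refine H.nd_l fun z => H.nd_r fun w => ?_
  rw [← rm1_mul, mul_assoc, mul_assoc, H.ΔL_T2, ← H.ΔLR, rm2_mul, ← mul_assoc, H.ΔR_T3]
  rfl
theorem C14 (H : AQG A) (a b q : A) : lm2 q (H.T1 (a ⊗ₜ b)) = rm1 b (H.T4 (a ⊗ₜ q)) := by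
  refine H.nd_l fun z => H.nd_r fun w => ?_
  rw [← rm2_mul, mul_assoc, mul_assoc, H.ΔL_T1, ← H.ΔLR, rm1_mul, ← mul_assoc, H.ΔR_T4]
  rfl
theorem LT1 (H : AQG A) (v x q : A) : H.ΔL v (H.T1 (x ⊗ₜ q)) = H.T1 ((v * x) ⊗ₜ q) := by
  refine H.nd_r fun z => ?_
  rw [← H.ΔL_assoc, H.ΔL_T1, H.ΔL_T1, H.ΔL_mul]
theorem LT2 (H : AQG A) (v x q : A) : H.ΔL v (H.T2 (x ⊗ₜ q)) = H.T2 ((v * x) ⊗ₜ q) := by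
  refine H.nd_r fun z => ?_
  rw [← H.ΔL_assoc, H.ΔL_T2, H.ΔL_T2, H.ΔL_mul]

/-- `v ↦ (ι ⊗ φ)(Δ(v)(1 ⊗ t))` -/
def P (H : AQG A) (t : A) : A →ₗ[ℂ] A :=
  sliceR H.phi ∘ₗ H.T2.toLinearMap ∘ₗ (TensorProduct.mk ℂ A A).flip t
def P' (H : AQG A) (b : A) : A →ₗ[ℂ] A :=
  sliceR H.phi ∘ₗ H.T2.toLinearMap ∘ₗ (TensorProduct.mk ℂ A A) b
theorem P_ap (H : AQG A) (t v : A) : H.P t v = sliceR H.phi (H.T2 (v ⊗ₜ t)) := by simp [P]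
theorem P'_ap (H : AQG A) (b v : A) : H.P' b v = sliceR H.phi (H.T2 (b ⊗ₜ v)) := by simp [P']

theorem slice_assoc_t (θ : A →ₗ[ℂ] ℂ) (w : A ⊗[ℂ] A) (z : A) :
    LinearMap.lTensor A (sliceR θ) (TensorProduct.assoc ℂ A A A (w ⊗ₜ z)) = θ z • w := by
  induction w with
  | zero => simp
  | tmul a b => simp [sliceR_tmul]
  | add x y hx hy => simp [map_add, add_tmul, hx, hy]

theorem slice_assoc (θ : A →ₗ[ℂ] ℂ) (F : A →ₗ[ℂ] A ⊗[ℂ] A) (ζ : A ⊗[ℂ] A) :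
    LinearMap.lTensor A (sliceR θ) (TensorProduct.assoc ℂ A A A (LinearMap.rTensor A F ζ))
      = F (sliceR θ ζ) := by
  induction ζ with
  | zero => simp
  | tmul a b => simp [slice_assoc_t, sliceR_tmul]
  | add x y hx hy => simp only [map_add, hx, hy]

theorem Q (H : AQG A) (t b p : A) :
    H.T3 (H.P t b ⊗ₜ p) = LinearMap.lTensor A (H.P t) (H.T3 (b ⊗ₜ p)) := by
  have h := congrArg (LinearMap.lTensor A (sliceR H.phi)) (H.coassoc p t b)
  rw [slice_assoc, ← LinearMap.lTensor_comp_apply] at h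
  simpa [P] using h

/-- `s ⊗ t ↦ (ι ⊗ φ)(Δ(b)(1 ⊗ t)) ⊗ s` -/
def K (H : AQG A) (b : A) : A ⊗[ℂ] A →ₗ[ℂ] A ⊗[ℂ] A :=
  (TensorProduct.comm ℂ A A).toLinearMap ∘ₗ LinearMap.lTensor A (H.P' b)
theorem K_t (H : AQG A) (b s t : A) : H.K b (s ⊗ₜ t) = H.P t b ⊗ₜ s := by
  simp [K, P_ap, P'_ap]

theorem sR_rm2 (θ : A →ₗ[ℂ] ℂ) (c : A) (z : A ⊗[ℂ] A) :
    sliceR θ (rm2 c z) = sliceR (θ ∘ₗ LinearMap.mulRight ℂ c) z := by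
  induction z with
  | zero => simp
  | tmul a b => simp [sliceR_tmul, rm2_t]
  | add x y hx hy => simp [map_add, hx, hy]
theorem sR_lm2 (θ : A →ₗ[ℂ] ℂ) (c : A) (z : A ⊗[ℂ] A) :
    sliceR θ (lm2 c z) = sliceR (θ ∘ₗ LinearMap.mulLeft ℂ c) z := by
  induction z with
  | zero => simp
  | tmul a b => simp [sliceR_tmul, lm2_t]
  | add x y hx hy => simp [map_add, hx, hy]
theorem sL_rm1 (θ : A →ₗ[ℂ] ℂ) (c : A) (z : A ⊗[ℂ] A) :
    sliceL θ (rm1 c z) = sliceL (θ ∘ₗ LinearMap.mulRight ℂ c) z := by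
  induction z with
  | zero => simp
  | tmul a b => simp [sliceL_tmul, rm1_t]
  | add x y hx hy => simp [map_add, hx, hy]

/-- p times `P` -/
theorem mul_P (H : AQG A) (p t b : A) :
    p * H.P t b = sliceR H.phi (rm2 t (H.T3 (b ⊗ₜ p))) := by
  rw [P_ap, ← sR_lm1, C23]

theorem P1aux (H : AQG A) (p b : A) (τ : A ⊗[ℂ] A) :
    lm1 p (H.T2 (H.K b τ)) =
      LinearMap.lTensor A (sliceR H.phi ∘ₗ H.ΔL.flip τ) (H.T3 (b ⊗ₜ p)) := by
  induction τ with
  | zero => simp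
  | add x y hx hy =>
    simp only [map_add, hx, hy, LinearMap.comp_add, LinearMap.lTensor_add, LinearMap.add_apply]
  | tmul s t =>
    rw [K_t, C23, Q, rm2, ← LinearMap.lTensor, ← LinearMap.lTensor_comp_apply]
    congr 2
    ext v
    simp [P_ap, ← sR_rm1, T2L]

theorem P1 (H : AQG A) (b x q : A) :
    H.T2 (H.K b (H.T1 (x ⊗ₜ q))) = H.P x b ⊗ₜ q := by
  refine H.nd_lm1 fun p => ?_
  rw [P1aux, lm1_t, mul_P]
  generalize H.T3 (b ⊗ₜ p) = κ
  induction κ with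
  | zero => simp
  | add x y hx hy => simp only [map_add, hx, hy, add_tmul]
  | tmul u v =>
    simp [LT1, H.left_inv_T1, rm2_t, sliceR_tmul, smul_tmul]

theorem SL (H : AQG A) (b x : A) : H.S (H.P x b) = sliceR H.phi (H.T4 (x ⊗ₜ b)) := by
  rw [← sub_eq_zero]
  refine H.nondeg_l _ fun q => ?_
  rw [sub_mul, sub_eq_zero]
  have h := congrArg (fun z => LinearMap.mul' ℂ A (LinearMap.rTensor A H.S.toLinearMap z)) (H.P1 b x q)
  simp only [LinearMap.rTensor_tmul, LinearMap.mul'_apply, LinearEquiv.coe_coe] at h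
  rw [← h, ← sR_rm1, ← C14]
  generalize H.T1 (x ⊗ₜ q) = τ
  induction τ with
  | zero => simp
  | add x y hx hy => simp only [map_add, hx, hy]
  | tmul s t =>
    rw [K_t, H.antipode_l, lm2_t, sliceR_tmul, P_ap, sliceRL, H.counit_T2]

theorem SW (H : AQG A) (θ η : A →ₗ[ℂ] ℂ) (b d x : A) (h : ∀ y, θ (y * d) = η (b * y)) :
    sliceR θ (H.T2 (x ⊗ₜ d)) = sliceR η (H.T4 (x ⊗ₜ b)) := by
  rw [← sub_eq_zero]
  refine H.nondeg_r _ fun p => ?_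
  rw [mul_sub, sub_eq_zero, ← sR_lm1, ← sR_lm1, C23, C34, sR_rm2, sR_lm2]
  congr 2
  ext y
  simp [h]

theorem SWL (H : AQG A) (θ η : A →ₗ[ℂ] ℂ) (b d x : A) (h : ∀ y, θ (y * d) = η (y * b)) :
    sliceL θ (H.T1 (x ⊗ₜ d)) = sliceL η (H.T1 (x ⊗ₜ b)) := by
  rw [← sub_eq_zero]
  refine H.nondeg_r _ fun p => ?_
  rw [mul_sub, sub_eq_zero, ← sL_lm2, ← sL_lm2, C14, C14, sL_rm1, sL_rm1]
  congr 2
  ext y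
  simp [h]

theorem T4P (H : AQG A) (b x : A) : sliceR H.phi (H.T4 (x ⊗ₜ b)) = H.P (H.rho b) x := by
  rw [P_ap]
  exact (H.SW _ _ b _ x fun y => (H.phi_kms b y).symm).symm

theorem A23a (H : AQG A) (b x w : A) :
    LinearMap.lTensor A H.S.toLinearMap (H.T2 (H.P x b ⊗ₜ w)) = H.K b (H.T3 (x ⊗ₜ H.S w)) := by
  refine H.nd_lm1 fun p => ?_
  have h1 : lm1 p (LinearMap.lTensor A H.S.toLinearMap (H.T2 (H.P x b ⊗ₜ w)))
      = LinearMap.lTensor A H.S.toLinearMap (lm1 p (H.T2 (H.P x b ⊗ₜ w))) := by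
    generalize H.T2 (H.P x b ⊗ₜ w) = z
    induction z with
    | zero => simp
    | tmul a b => simp [lm1_t]
    | add x y hx hy => simp only [map_add, hx, hy]
  rw [h1, C23, Q, rm2, ← LinearMap.lTensor, ← LinearMap.lTensor_comp_apply,
    ← LinearMap.lTensor_comp_apply]
  have h2 : ∀ v, (H.S.toLinearMap ∘ₗ LinearMap.mulRight ℂ w ∘ₗ H.P x) v
      = sliceR H.phi (lm2 v (H.T3 (x ⊗ₜ H.S w))) := by
    intro v
    simp [H.S_mul, SL, ← sR_lm1, C34]
  have h3 : ∀ (τ : A ⊗[ℂ] A) (F : A →ₗ[ℂ] A), (∀ v, F v = sliceR H.phi (lm2 v τ)) →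
      LinearMap.lTensor A F (H.T3 (b ⊗ₜ p)) = lm1 p (H.K b τ) := by
    intro τ F hF
    let G : A ⊗[ℂ] A →ₗ[ℂ] A →ₗ[ℂ] A := TensorProduct.lift
      (LinearMap.mk₂ ℂ (fun u v => (H.phi ∘ₗ LinearMap.mulRight ℂ v).smulRight u)
        (by intros; ext; simp) (by intros; ext; simp only [LinearMap.smulRight_apply, LinearMap.smul_apply]; rw [smul_comm])
        (by intros; ext; simp [mul_add, add_smul]) (by intros; ext; simp [mul_smul_comm, mul_smul]))
    have hG : F = G τ := by
      ext v
      rw [hF]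
      generalize τ = τ
      induction τ with
      | zero => simp
      | add x y hx hy => simp only [map_add, hx, hy, LinearMap.add_apply]
      | tmul u v => simp [G, lm2_t, sliceR_tmul]
    rw [hG]
    clear hG hF
    induction τ with
    | zero => simp
    | add x y hx hy => simp only [map_add, hx, hy, LinearMap.lTensor_add, LinearMap.add_apply]
    | tmul u v =>
      rw [K_t, lm1_t, mul_P]
      generalize H.T3 (b ⊗ₜ p) = κ
      induction κ with
      | zero => simp
      | add x y hx hy => simp only [map_add, hx, hy, add_tmul]
      | tmul u v => simp [G, rm2_t, sliceR_tmul, smul_tmul]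
  exact h3 _ _ h2

theorem exists_phi (H : AQG A) : ∃ q, H.phi q = 1 := by
  by_contra! h
  apply H.phi_ne
  ext x
  by_contra hx
  exact h ((H.phi x)⁻¹ • x) (by simpa using inv_mul_cancel₀ hx)

theorem span2 (H : AQG A) (a : A) : ∃ t : A ⊗[ℂ] A, sliceR H.phi (H.T2 t) = a := by
  obtain ⟨q, hq⟩ := H.exists_phi
  exact ⟨H.T2.symm (a ⊗ₜ q), by simp [sliceR_tmul, hq]⟩
theorem span1 (H : AQG A) (a : A) : ∃ t : A ⊗[ℂ] A, sliceL H.phi (H.T1 t) = a := by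
  obtain ⟨q, hq⟩ := H.exists_phi
  exact ⟨H.T1.symm (q ⊗ₜ a), by simp [sliceL_tmul, hq]⟩

theorem A23 (H : AQG A) (a w : A) : H.sw (H.T2 (a ⊗ₜ w)) = H.T3 (H.S a ⊗ₜ H.S w) := by
  obtain ⟨t, rfl⟩ := H.span2 a
  induction t with
  | zero => simp
  | add x y hx hy => simp only [map_add, add_tmul, hx, hy]
  | tmul b x =>
    rw [← P_ap, SL, T4P, Q]
    have h1 : ∀ z, H.sw z = TensorProduct.comm ℂ A A (LinearMap.rTensor A H.S.toLinearMap
        (LinearMap.lTensor A H.S.toLinearMap z)) := by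
      intro z
      induction z with
      | zero => simp
      | tmul a b => simp [sw_t]
      | add x y hx hy => simp only [map_add, hx, hy]
    rw [h1, A23a]
    generalize H.T3 (x ⊗ₜ H.S w) = κ
    induction κ with
    | zero => simp
    | add x y hx hy => simp only [map_add, hx, hy]
    | tmul u v => simp [K_t, SL, T4P]

theorem A32 (H : AQG A) (a w : A) : H.sw (H.T3 (a ⊗ₜ w)) = H.T2 (H.S a ⊗ₜ H.S w) := by
  refine H.nd_lm1 fun q => ?_
  obtain ⟨q, rfl⟩ := H.S.surjective q
  rw [C23, ← A23, ← sw_rm2, ← sw_lm1, C23]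
theorem A41 (H : AQG A) (a w : A) : H.sw (H.T4 (a ⊗ₜ w)) = H.T1 (H.S a ⊗ₜ H.S w) := by
  refine H.nd_rm2 fun q => ?_
  obtain ⟨q, rfl⟩ := H.S.surjective q
  rw [← C12, ← A32, ← sw_lm1, ← sw_lm2, C34]
theorem A14 (H : AQG A) (a w : A) : H.sw (H.T1 (a ⊗ₜ w)) = H.T4 (H.S a ⊗ₜ H.S w) := by
  refine H.nd_lm1 fun q => ?_
  obtain ⟨q, rfl⟩ := H.S.surjective q
  rw [C34, ← A23, ← sw_rm2, ← sw_rm1, C12]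

theorem right_inv (H : AQG A) (a b : A) : sliceL H.psi (H.T2 (a ⊗ₜ b)) = H.psi a • b := by
  apply H.S.injective
  have := H.left_inv_T3 (H.S a) (H.S b)
  rw [← A23, sR_sw] at this
  simpa [psi] using this

theorem SR (H : AQG A) (b x : A) :
    H.S (sliceL H.psi (H.T3 (b ⊗ₜ x))) = sliceL H.psi (H.T1 (x ⊗ₜ b)) := by
  apply H.S.injective
  have h := H.SL (H.S b) (H.S x)
  rwa [P_ap, ← A32, ← A14, sR_sw, sR_sw] at h

theorem phipsi (H : AQG A) (t t' : A ⊗[ℂ] A) (h : H.T1 t = H.T2 t') (x : A) :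
    H.phi (x * sliceR H.psi t) = H.psi (x * sliceR H.phi t') := by
  have h1 : H.phi (x * sliceR H.psi t) = H.psi (sliceR H.phi (H.ΔL x (H.T1 t))) := by
    generalize t = t
    induction t with
    | zero => simp
    | add x y hx hy => simp only [map_add, mul_add, hx, hy]
    | tmul p q =>
      rw [LT1, H.left_inv_T1]
      simp [sliceR_tmul, mul_smul_comm, mul_comm]
  have h2 : H.psi (x * sliceR H.phi t') = H.psi (sliceR H.phi (H.ΔL x (H.T2 t'))) := by
    generalize t' = t
    induction t with
    | zero => simp
    | add x y hx hy => simp only [map_add, mul_add, hx, hy]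
    | tmul p q =>
      rw [LT2, sliceRL, H.right_inv]
      simp [sliceR_tmul, mul_smul_comm, mul_comm]
  rw [h1, h2, h]

theorem exists_psi (H : AQG A) : ∃ q, H.psi q = 1 := by
  obtain ⟨q, hq⟩ := H.exists_phi
  exact ⟨H.S.symm q, by simpa [psi] using hq⟩

theorem phi_to_psi (H : AQG A) (d : A) : ∃ a, ∀ x, H.phi (x * d) = H.psi (x * a) := by
  obtain ⟨q, hq⟩ := H.exists_psi
  refine ⟨sliceR H.phi (H.T2.symm (H.T1 (d ⊗ₜ q))), fun x => ?_⟩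
  rw [← H.phipsi (d ⊗ₜ q) (H.T2.symm (H.T1 (d ⊗ₜ q))) (by simp) x]
  simp [sliceR_tmul, hq]
theorem psi_to_phi (H : AQG A) (a : A) : ∃ d, ∀ x, H.phi (x * d) = H.psi (x * a) := by
  obtain ⟨q, hq⟩ := H.exists_phi
  refine ⟨sliceR H.psi (H.T1.symm (H.T2 (a ⊗ₜ q))), fun x => ?_⟩
  · rw [H.phipsi (H.T1.symm (H.T2 (a ⊗ₜ q))) (a ⊗ₜ q) (by simp) x]
    simp [sliceR_tmul, hq]

theorem N1 (H : AQG A) (b d x : A) (h : ∀ y, H.phi (y * d) = H.phi (H.S y * b)) :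
    H.S (sliceR H.phi (H.T2 (x ⊗ₜ d))) = sliceL H.phi (H.T1 (H.S x ⊗ₜ b)) := by
  obtain ⟨b, rfl⟩ := H.S.surjective b
  rw [← A41, sL_sw]
  congr 1
  refine H.SW _ _ _ _ _ fun y => ?_
  rw [h, ← H.S_mul]
  rfl

theorem N4 (H : AQG A) (ω : A →ₗ[ℂ] ℂ) (hω : H.HasSlices ω) (b : A) :
    ∃ c, H.Lact ω b = H.lFun c := by
  obtain ⟨a, ha⟩ := H.phi_to_psi b
  obtain ⟨e, he, -⟩ := (hω (H.S a)).2
  obtain ⟨c, hc⟩ := H.psi_to_phi (H.S.symm e)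
  refine ⟨c, ?_⟩
  ext x
  have h1 : H.lFun c x = H.psi (x * H.S.symm e) := hc x
  have h2 : H.psi (x * H.S.symm e) = H.phi (e * H.S x) := by simp [psi, H.S_mul]
  have h3 : H.Lact ω b x = ω (sliceL H.phi (H.T1 (x ⊗ₜ b))) := by simp [Lact]
  rw [h1, h2, he, ← A32, h3, H.SWL _ H.psi a b x ha, ← SR, ← sliceRL, sR_sw]
  rfl

theorem N5 (H : AQG A) (ω : A →ₗ[ℂ] ℂ) (hω : H.HasSlices ω) (b : A) :
    ∃ c, H.Ract ω b = H.lFun c := by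
  obtain ⟨u, rfl⟩ := H.S.surjective b
  obtain ⟨e, he, -⟩ := (hω u).1
  refine ⟨H.S e, ?_⟩
  ext x
  obtain ⟨y, rfl⟩ := H.S.surjective x
  have h1 : H.lFun (H.S e) (H.S y) = H.psi (e * y) := by simp [lFun, psi, H.S_mul]
  have h2 : H.Ract ω (H.S u) (H.S y) = ω (H.P (H.S u) (H.S y)) := by simp [Ract, P]
  have h3 : H.P (H.S u) (H.S y) = sliceL H.psi (H.T1 (u ⊗ₜ y)) := by
    apply H.S.injective
    rw [SL, ← A14, sR_sw]
    rfl
  rw [h1, h2, h3, he, sliceRL]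

end Aux
end AQG

/-- For `ω ∈ M(Â)`, the extensions of the dual antipode and its
inverse satisfy `Ŝ(ω) = ω ∘ S` and `Ŝ⁻¹(ω) = ω ∘ S⁻¹`.  On `Â`, `Ŝ(η) = η ∘ S`, and the
extension to `M(Â)` is characterized by `Ŝ(ω)Ŝ(η) = Ŝ(ηω)` (resp.
`Ŝ⁻¹(η)Ŝ⁻¹(ω) = Ŝ⁻¹(ωη)`) for `η ∈ Â`. -/
theorem AQG.dual_antipode_formula {A : Type*} [NonUnitalRing A] [Module ℂ A]
    [SMulCommClass ℂ A A] [IsScalarTower ℂ A A] (H : AQG A)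
    (ω : A →ₗ[ℂ] ℂ) (hω : H.HasSlices ω) (σ σ' : A →ₗ[ℂ] ℂ)
    -- `σ = Ŝ(ω)` : whenever `(φb)ω = φc` and `(φb) ∘ S = φd ∈ Â`, one has
    -- `σ · ((φb) ∘ S) = (φc) ∘ S`
    (hσ : ∀ b c d : A, H.Lact ω b = H.lFun c →
      H.lFun d = H.lFun b ∘ₗ H.S.toLinearMap →
      H.Ract σ d = H.lFun c ∘ₗ H.S.toLinearMap)
    -- `σ' = Ŝ⁻¹(ω)` : whenever `ω(φb) = φc` and `(φb) ∘ S⁻¹ = φd ∈ Â`, one has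
    -- `((φb) ∘ S⁻¹) · σ' = (φc) ∘ S⁻¹`
    (hσ' : ∀ b c d : A, H.Ract ω b = H.lFun c →
      H.lFun d = H.lFun b ∘ₗ H.S.symm.toLinearMap →
      H.Lact σ' d = H.lFun c ∘ₗ H.S.symm.toLinearMap) :
    σ = ω ∘ₗ H.S.toLinearMap ∧ σ' = ω ∘ₗ H.S.symm.toLinearMap := by
  constructor
  · ext a
    obtain ⟨t, rfl⟩ := H.span2 a
    induction t with
    | zero => simp
    | add x y hx hy => simp only [map_add, hx, hy]
    | tmul x d =>
      obtain ⟨a, ha⟩ := H.phi_to_psi d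
      have hb : ∀ y, H.phi (y * d) = H.phi (H.S y * H.rho (H.S a)) := fun y => by
        rw [ha, ← H.phi_kms, ← H.S_mul]; rfl
      obtain ⟨c, hc⟩ := H.N4 ω hω (H.rho (H.S a))
      have h := hσ _ c d hc (by ext y; exact hb y)
      rw [← hc] at h
      have h' := LinearMap.congr_fun h x
      have h1 : H.Ract σ d x = σ (sliceR H.phi (H.T2 (x ⊗ₜ d))) := by simp [AQG.Ract]
      rw [← h1, h', LinearMap.comp_apply, LinearEquiv.coe_coe, LinearMap.comp_apply,
        LinearEquiv.coe_coe, H.N1 _ d x hb]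
      simp [AQG.Lact]
  · ext a
    obtain ⟨t, rfl⟩ := H.span1 a
    induction t with
    | zero => simp
    | add x y hx hy => simp only [map_add, hx, hy]
    | tmul x d =>
      obtain ⟨x, rfl⟩ := H.S.surjective x
      obtain ⟨b, hb'⟩ := H.psi_to_phi (H.S.symm (H.rho.symm d))
      have hb : ∀ y, H.phi (y * b) = H.phi (H.S y * d) := fun y => by
        have := H.phi_kms (H.rho.symm d) (H.S y)
        rw [LinearEquiv.apply_symm_apply] at this
        rw [hb', ← this]
        simp [AQG.psi, H.S_mul]
      obtain ⟨c, hc⟩ := H.N5 ω hω b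
      have h := hσ' b c d hc (by
        ext y
        obtain ⟨y, rfl⟩ := H.S.surjective y
        simpa [AQG.lFun] using (hb y).symm)
      rw [← hc] at h
      have h' := LinearMap.congr_fun h (H.S x)
      have h1 : H.Lact σ' d (H.S x) = σ' (sliceL H.phi (H.T1 (H.S x ⊗ₜ d))) := by
        simp [AQG.Lact]
      rw [← h1, h', LinearMap.comp_apply, LinearEquiv.coe_coe, LinearMap.comp_apply,
        LinearEquiv.coe_coe, ← H.N1 _ b x hb]
      simp [AQG.Ract]
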